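/- For every regular uncountable cardinal κ there exists a complete Boolean algebra B such that: (i) B is atomless; (ii) the only automorphism of B is the identity; (iii) every complete subalgebra of B that is atomless is either the two-element subalgebra {⊥, ⊤} or all of B; and (iv) there is a subset of B of cardinality at most κ that is not contained in any proper complete subalgebra of B (i.e., B has κ complete generators). -/

import Mathlib

/-- `A` is a complete subalgebra of the complete Boolean algebra `B`: it contains `⊥` and
`⊤`, is closed under complementation, and is closed under arbitrary suprema (hence also
arbitrary infima) as computed in `B`. -/
def IsCompleteSubalgebra {B : Type*} [CompleteBooleanAlgebra B] (A : Set B) : Prop :=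
  ⊥ ∈ A ∧ ⊤ ∈ A ∧ (∀ a ∈ A, aᶜ ∈ A) ∧ ∀ X ⊆ A, sSup X ∈ A

namespace SimpleAlgebra

/-! ### Complete subalgebras -/

section Subalgebra

variable {B : Type*} [CompleteBooleanAlgebra B] {A : Set B}

theorem sInf_mem_of_isCompleteSubalgebra (hA : IsCompleteSubalgebra A) {X : Set B} (hX : X ⊆ A) :
    sInf X ∈ A := by
  have h : sInf X = (sSup (compl '' X))ᶜ := by
    rw [compl_sSup', Set.image_image]
    simp
  rw [h]
  refine hA.2.2.1 _ (hA.2.2.2 _ ?_)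
  rintro _ ⟨x, hx, rfl⟩
  exact hA.2.2.1 x (hX hx)

theorem inf_mem_of_isCompleteSubalgebra (hA : IsCompleteSubalgebra A) {a b : B} (ha : a ∈ A)
    (hb : b ∈ A) : a ⊓ b ∈ A := by
  rw [← sInf_pair]
  exact sInf_mem_of_isCompleteSubalgebra hA (by rintro x (rfl | rfl) <;> assumption)

/-- The least element of `A` above `b`. -/
def upper (A : Set B) (b : B) : B :=
  sInf {a | a ∈ A ∧ b ≤ a}

theorem upper_mem (hA : IsCompleteSubalgebra A) (b : B) : upper A b ∈ A :=
  sInf_mem_of_isCompleteSubalgebra hA fun _ h => h.1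

theorem le_upper (A : Set B) (b : B) : b ≤ upper A b :=
  le_sInf fun _ h => h.2

theorem upper_le {a b : B} (ha : a ∈ A) (h : b ≤ a) : upper A b ≤ a :=
  sInf_le ⟨ha, h⟩

theorem upper_mono {b c : B} (h : b ≤ c) : upper A b ≤ upper A c :=
  le_sInf fun _ ha => upper_le ha.1 (h.trans ha.2)

theorem upper_inf_eq_bot {a b : B} (hA : IsCompleteSubalgebra A) (ha : a ∈ A) (h : b ⊓ a = ⊥) :
    upper A b ⊓ a = ⊥ := by
  rw [← disjoint_iff, ← le_compl_iff_disjoint_right] at h ⊢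
  exact upper_le (hA.2.2.1 a ha) h

/-- An element outside `A` yields two disjoint nonzero elements that `A` does not tell apart. -/
theorem exists_upper_eq_upper (hA : IsCompleteSubalgebra A) {b : B} (hb : b ∉ A) :
    ∃ p q : B, p ⊓ q = ⊥ ∧ q ≠ ⊥ ∧ q ≤ upper A p ∧ p ≤ upper A q := by
  set l := (upper A bᶜ)ᶜ with hl
  have hlA : l ∈ A := hA.2.2.1 _ (upper_mem hA _)
  have hlb : l ≤ b := compl_le_of_compl_le (le_upper A bᶜ)
  set c := upper A b ⊓ lᶜ with hc
  have hcA : c ∈ A := inf_mem_of_isCompleteSubalgebra hA (upper_mem hA _) (hA.2.2.1 _ hlA)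
  have key₁ : c ≤ upper A (b ⊓ c) := by
    have h : b ≤ upper A (b ⊓ c) ⊔ cᶜ := by
      calc b = b ⊓ c ⊔ b ⊓ cᶜ := (sup_inf_inf_compl).symm
        _ ≤ _ := sup_le_sup (le_upper A _) inf_le_right
    have h2 : upper A (b ⊓ c) ⊔ cᶜ ∈ A := by
      have := hA.2.2.1 _ (inf_mem_of_isCompleteSubalgebra hA
        (hA.2.2.1 _ (upper_mem hA (b ⊓ c))) hcA)
      simpa using this
    have h3 : c ≤ upper A (b ⊓ c) ⊔ cᶜ := inf_le_left.trans (upper_le h2 h)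
    calc c = (upper A (b ⊓ c) ⊔ cᶜ) ⊓ c := (inf_eq_right.2 h3).symm
      _ = upper A (b ⊓ c) ⊓ c := by rw [inf_sup_right]; simp
      _ ≤ _ := inf_le_left
  have key₂ : c ≤ upper A (bᶜ ⊓ c) := by
    have h : bᶜ ≤ upper A (bᶜ ⊓ c) ⊔ cᶜ := by
      calc bᶜ = bᶜ ⊓ c ⊔ bᶜ ⊓ cᶜ := (sup_inf_inf_compl).symm
        _ ≤ _ := sup_le_sup (le_upper A _) inf_le_right
    have h2 : upper A (bᶜ ⊓ c) ⊔ cᶜ ∈ A := by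
      have := hA.2.2.1 _ (inf_mem_of_isCompleteSubalgebra hA
        (hA.2.2.1 _ (upper_mem hA (bᶜ ⊓ c))) hcA)
      simpa using this
    have h3 : c ≤ upper A (bᶜ ⊓ c) ⊔ cᶜ := by
      refine le_trans ?_ (upper_le h2 h)
      rw [hc, hl, compl_compl]
      exact inf_le_right
    calc c = (upper A (bᶜ ⊓ c) ⊔ cᶜ) ⊓ c := (inf_eq_right.2 h3).symm
      _ = upper A (bᶜ ⊓ c) ⊓ c := by rw [inf_sup_right]; simp
      _ ≤ _ := inf_le_left
  refine ⟨b ⊓ c, bᶜ ⊓ c, ?_, ?_, inf_le_right.trans key₁, inf_le_right.trans key₂⟩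
  · rw [inf_inf_inf_comm, inf_compl_self, bot_inf_eq]
  · intro h
    rw [h] at key₂
    have h0 : upper A (⊥ : B) = ⊥ := le_bot_iff.1 (upper_le hA.1 le_rfl)
    rw [h0, le_bot_iff, hc, ← disjoint_iff, disjoint_compl_right_iff] at key₂
    exact hb (le_antisymm ((le_upper A b).trans key₂) hlb ▸ hlA)

/-- If an automorphism of an atomless complete Boolean algebra moves some element, then its
graph on a suitable principal ideal determines a proper atomless complete subalgebra. -/
theorem eq_self_of_forall_atomless_eq_univ (hatom : ∀ b : B, ¬ IsAtom b)
    (hsimple : ∀ A : Set B, IsCompleteSubalgebra A →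
      (∀ a ∈ A, a ≠ ⊥ → ∃ b ∈ A, ⊥ < b ∧ b < a) → A = Set.univ)
    (e : B ≃o B) (x : B) : e x = x := by
  by_contra hne
  have hcompl : ∀ b, e bᶜ = (e b)ᶜ := fun b => (e.isCompl isCompl_compl).compl_eq.symm
  obtain ⟨y, hy⟩ : ∃ y, ¬ y ≤ e y := by
    by_contra! h
    refine hne (le_antisymm ?_ (h x))
    have := h xᶜ
    rwa [hcompl, compl_le_compl_iff_le] at this
  obtain ⟨z, hz, hze⟩ : ∃ z, z ≠ ⊥ ∧ z ⊓ e z = ⊥ := by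
    refine ⟨y ⊓ (e y)ᶜ, fun h => hy ?_, ?_⟩
    · rwa [← disjoint_iff, disjoint_compl_right_iff] at h
    · refine le_bot_iff.1 ((inf_le_inf inf_le_right (e.monotone inf_le_left)).trans ?_)
      rw [compl_inf_self]
  have hinf : ∀ b c, e (b ⊓ c) = e b ⊓ e c := fun b c => e.map_inf b c
  set A : Set B := {b | e (b ⊓ z) = b ⊓ e z} with hAdef
  have hA : IsCompleteSubalgebra A := by
    refine ⟨by simp [A], by simp [A], ?_, ?_⟩
    · intro a ha
      change e (a ⊓ z) = a ⊓ e z at ha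
      change e (aᶜ ⊓ z) = aᶜ ⊓ e z
      have h1 : aᶜ ⊓ z = (a ⊓ z)ᶜ ⊓ z := by
        rw [compl_inf, inf_sup_right, compl_inf_self, sup_bot_eq]
      have h2 : aᶜ ⊓ e z = (a ⊓ e z)ᶜ ⊓ e z := by
        rw [compl_inf, inf_sup_right, compl_inf_self, sup_bot_eq]
      rw [h1, hinf, hcompl, ha, ← h2]
    · intro X hX
      change e (sSup X ⊓ z) = sSup X ⊓ e z
      rw [sSup_inf_eq, sSup_inf_eq, OrderIso.map_iSup]
      refine iSup_congr fun a => ?_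
      rw [OrderIso.map_iSup]
      exact iSup_congr fun ha => hX ha
  have hsplit : ∀ b : B, b ≠ ⊥ → ∃ c, ⊥ < c ∧ c < b := by
    intro b hb
    by_contra! h
    refine hatom b ⟨hb, fun c hc => ?_⟩
    by_contra hc0
    exact h c (bot_lt_iff_ne_bot.2 hc0) hc
  have huniv : A = Set.univ := by
    refine hsimple A hA fun a ha ha0 => ?_
    change e (a ⊓ z) = a ⊓ e z at ha
    by_cases haz : a ⊓ z = ⊥
    · obtain ⟨c, hc0, hca⟩ := hsplit a ha0
      refine ⟨c, ?_, hc0, hca⟩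
      change e (c ⊓ z) = c ⊓ e z
      have h1 : c ⊓ z = ⊥ := le_bot_iff.1 ((inf_le_inf_right z hca.le).trans haz.le)
      have h2 : c ⊓ e z = ⊥ := by
        refine le_bot_iff.1 ((inf_le_inf_right _ hca.le).trans ?_)
        rw [← ha, haz, OrderIso.map_bot]
      rw [h1, h2, OrderIso.map_bot]
    · obtain ⟨c, hc0, hca⟩ := hsplit _ haz
      have hcz : c ≤ z := hca.le.trans inf_le_right
      have h1 : e c ⊓ z = ⊥ :=
        le_bot_iff.1 ((inf_le_inf_right z (e.monotone hcz)).trans ((inf_comm _ _).trans hze).le)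
      have h2 : c ⊓ e z = ⊥ := le_bot_iff.1 ((inf_le_inf_right _ hcz).trans hze.le)
      have h3 : (c ⊔ e c) ⊓ z = c := by
        rw [inf_sup_right, h1, sup_bot_eq, inf_eq_left.2 hcz]
      refine ⟨c ⊔ e c, ?_, hc0.trans_le le_sup_left, lt_of_le_of_ne ?_ ?_⟩
      · change e ((c ⊔ e c) ⊓ z) = (c ⊔ e c) ⊓ e z
        rw [h3, inf_sup_right, h2, bot_sup_eq, inf_eq_left.2 (e.monotone hcz)]
      · refine sup_le (hca.le.trans inf_le_left) ((e.monotone hca.le).trans ?_)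
        rw [ha]
        exact inf_le_left
      · intro h
        rw [h] at h3
        exact hca.ne h3.symm
  have hzA : z ∈ A := huniv ▸ Set.mem_univ z
  change e (z ⊓ z) = z ⊓ e z at hzA
  rw [inf_idem, hze] at hzA
  exact hz ((map_eq_bot_iff e).1 hzA)

end Subalgebra

/-! ### The completion of a preorder -/

section Completion

/-- `ι` behaves like the canonical map of a forcing notion into its Boolean completion. -/
structure IsCompletion {P : Type*} [Preorder P] {B : Type*} [CompleteBooleanAlgebra B]
    (ι : P → B) : Prop where
  mono : Monotone ι
  ne_bot : ∀ p, ι p ≠ ⊥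
  dense : ∀ b, b ≠ ⊥ → ∃ p, ι p ≤ b
  compat : ∀ p q, ι p ⊓ ι q ≠ ⊥ → ∃ r, r ≤ p ∧ r ≤ q

theorem IsCompletion.exists_le {P : Type*} [Preorder P] {B : Type*} [CompleteBooleanAlgebra B]
    {ι : P → B} (hι : IsCompletion ι) {p : P} {b : B} (h : ι p ⊓ b ≠ ⊥) :
    ∃ q ≤ p, ι q ≤ b := by
  obtain ⟨r, hr⟩ := hι.dense _ h
  obtain ⟨q, hqr, hqp⟩ := hι.compat r p (by
    rw [inf_eq_left.2 (hr.trans inf_le_left)]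
    exact hι.ne_bot r)
  exact ⟨q, hqp, (hι.mono hqr).trans (hr.trans inf_le_right)⟩

theorem isLUB_toRegular_sSup {α : Type*} [Order.Frame α] (X : Set (Heyting.Regular α)) :
    IsLUB X (Heyting.Regular.toRegular (sSup (Heyting.Regular.val '' X))) := by
  refine ⟨fun x hx => ?_, fun y hy => ?_⟩
  · rw [← Heyting.Regular.toRegular_coe x]
    exact Heyting.Regular.toRegular.monotone (le_sSup ⟨x, hx, rfl⟩)
  · rw [← Heyting.Regular.toRegular_coe y]
    refine Heyting.Regular.toRegular.monotone (sSup_le ?_)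
    rintro _ ⟨x, hx, rfl⟩
    exact Heyting.Regular.coe_le_coe.2 (hy hx)

noncomputable instance regularCompleteBooleanAlgebra (α : Type*) [Order.Frame α] :
    CompleteBooleanAlgebra (Heyting.Regular α) where
  __ := (inferInstance : BooleanAlgebra (Heyting.Regular α))
  sSup X := Heyting.Regular.toRegular (sSup (Heyting.Regular.val '' X))
  sInf X := (Heyting.Regular.toRegular (sSup (Heyting.Regular.val '' (compl '' X))))ᶜ
  isLUB_sSup X := isLUB_toRegular_sSup X
  isGLB_sInf X := by
    have h := isLUB_toRegular_sSup (compl '' X)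
    refine ⟨fun x hx => compl_le_of_compl_le (h.1 ⟨x, hx, rfl⟩), fun y hy => ?_⟩
    refine le_compl_comm.1 (h.2 ?_)
    rintro _ ⟨x, hx, rfl⟩
    exact compl_le_compl (hy hx)

theorem exists_isCompletion (P : Type) [Preorder P] :
    ∃ (B : Type u) (_ : CompleteBooleanAlgebra B) (ι : P → B), IsCompletion ι := by
  let j : P → LowerSet (ULift.{u} P) := fun p => LowerSet.Iic (ULift.up p)
  have hj : ∀ p, Heyting.Regular.toRegular (j p) ≠ ⊥ := by
    intro p h
    have h1 : j p ≤ ((Heyting.Regular.toRegular (j p) : Heyting.Regular _) : LowerSet _) :=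
      le_compl_compl
    rw [h, Heyting.Regular.coe_bot] at h1
    exact h1 (show ULift.up p ∈ j p from le_rfl)
  refine ⟨Heyting.Regular (LowerSet (ULift.{u} P)), inferInstance,
    fun p => Heyting.Regular.toRegular (j p), ?_, hj, ?_, ?_⟩
  · intro p q h
    exact Heyting.Regular.toRegular.monotone (LowerSet.Iic_le.2 h)
  · intro b hb
    have hb' : (b : LowerSet (ULift.{u} P)) ≠ ⊥ := fun h => hb (Heyting.Regular.coe_injective h)
    obtain ⟨p, hp⟩ : ∃ p, p ∈ (b : LowerSet (ULift.{u} P)) := by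
      by_contra! h
      exact hb' (le_bot_iff.1 fun x hx => (h x hx).elim)
    refine ⟨p.down, ?_⟩
    rw [← Heyting.Regular.toRegular_coe b]
    exact Heyting.Regular.toRegular.monotone (LowerSet.Iic_le.2 hp)
  · intro p q h
    by_contra! hpq
    have hd : j p ⊓ j q = ⊥ := by
      refine le_bot_iff.1 fun x hx => ?_
      exact (hpq x.down hx.1 hx.2).elim
    refine h (Heyting.Regular.coe_injective ?_)
    refine (Heyting.Regular.coe_inf _ _).trans ?_
    rw [Heyting.Regular.coe_toRegular, Heyting.Regular.coe_toRegular,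
      ← compl_compl_inf_distrib, hd, Heyting.Regular.coe_bot, compl_bot, compl_top]

end Completion

/-! ### Trees -/

section Trees

/-- `bound m` bounds the number of branches through the nodes of index less than `m`. -/
def bound : ℕ → ℕ
  | 0 => 1
  | m + 1 => bound m * (bound m ^ m + 1)

/-- The number of successors in the full tree of a node of index `m`. -/
def width (m : ℕ) : ℕ := bound m ^ m + 1

theorem width_pos (m : ℕ) : 0 < width m := Nat.succ_pos _

theorem bound_eq_prod (m : ℕ) : bound m = ∏ i ∈ Finset.range m, width i := by
  induction m with
  | zero => rfl
  | succ m ih => rw [Finset.prod_range_succ, ← ih]; rfl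

theorem bound_pos (m : ℕ) : 0 < bound m := by
  rw [bound_eq_prod]
  exact Finset.prod_pos fun i _ => width_pos i

open Classical in
/-- The labels of the successors of the node `u` in `T`. Nodes are finite sequences, written with
the last entry first. -/
noncomputable def succs (T : Set (List ℕ)) (u : List ℕ) : Finset ℕ :=
  (Finset.range (width (Encodable.encode u))).filter fun i => i :: u ∈ T

/-- The node `u` has many successors in `T`. -/
def IsBig (T : Set (List ℕ)) (n : ℕ) (u : List ℕ) : Prop :=
  bound (Encodable.encode u) ^ n < (succs T u).card

theorem mem_succs {T : Set (List ℕ)} {u : List ℕ} {i : ℕ} :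
    i ∈ succs T u ↔ i < width (Encodable.encode u) ∧ i :: u ∈ T := by
  simp [succs]

theorem succs_mono {T S : Set (List ℕ)} (h : T ⊆ S) (u : List ℕ) : succs T u ⊆ succs S u :=
  fun _ hi => mem_succs.2 ⟨(mem_succs.1 hi).1, h (mem_succs.1 hi).2⟩

theorem IsBig.mono {T S : Set (List ℕ)} {n m : ℕ} {u : List ℕ} (h : IsBig T n u) (hTS : T ⊆ S)
    (hmn : m ≤ n) : IsBig S m u :=
  (Nat.pow_le_pow_right (bound_pos _) hmn).trans_lt
    (lt_of_lt_of_le h (Finset.card_le_card (succs_mono hTS u)))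

theorem exists_ne_of_bound_pow_lt_card {K : Finset ℕ} {m n : ℕ} (h : bound m ^ n < K.card) :
    ∃ i ∈ K, ∃ j ∈ K, i ≠ j :=
  Finset.one_lt_card.1 (lt_of_le_of_lt (Nat.one_le_pow _ _ (bound_pos _)) h)

/-- The forcing conditions: trees of finite sequences in which every node has extensions with
arbitrarily large norm. -/
structure Tree where
  carrier : Set (List ℕ)
  nil_mem : [] ∈ carrier
  tail_mem : ∀ i s, i :: s ∈ carrier → s ∈ carrier
  lt_width : ∀ i s, i :: s ∈ carrier → i < width (Encodable.encode s)
  exists_isBig : ∀ t ∈ carrier, ∀ n, ∃ u ∈ carrier, t <:+ u ∧ IsBig carrier n u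

instance : Preorder Tree := Preorder.lift Tree.carrier

theorem eq_of_cons_suffix_of_cons_suffix {i j : ℕ} {s t : List ℕ} (hi : i :: s <:+ t)
    (hj : j :: s <:+ t) : i = j := by
  have h := List.suffix_of_suffix_length_le hi hj (by simp)
  have := h.eq_of_length (by simp)
  simpa using this

theorem encode_lt_of_cons_suffix {i : ℕ} {s t : List ℕ} (h : i :: s <:+ t) :
    Encodable.encode s < Encodable.encode t := by
  induction t with
  | nil => simp at h
  | cons a t ih =>
    have h1 : Encodable.encode t < Encodable.encode (a :: t) := by
      rw [Encodable.encode_list_cons]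
      exact Nat.lt_succ_of_le (Nat.right_le_pair _ _)
    rcases List.suffix_cons_iff.1 h with h | h
    · simp only [List.cons.injEq] at h
      rw [h.2]
      exact h1
    · exact (ih h).trans h1

theorem exists_cons_suffix {s t : List ℕ} (h : s <:+ t) (hne : s ≠ t) : ∃ i, i :: s <:+ t := by
  obtain ⟨l, rfl⟩ := h
  rcases List.eq_nil_or_concat l with rfl | ⟨l', a, rfl⟩
  · simp at hne
  · exact ⟨a, l', by simp⟩

theorem Tree.mem_of_suffix (T : Tree) {s t : List ℕ} (ht : t ∈ T.carrier) (h : s <:+ t) :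
    s ∈ T.carrier := by
  induction t with
  | nil => rw [List.suffix_nil.1 h]; exact T.nil_mem
  | cons a t ih =>
    rcases List.suffix_cons_iff.1 h with rfl | h
    · exact ht
    · exact ih (T.tail_mem a t ht) h

theorem Tree.cons_mem_succs (T : Tree) {u : List ℕ} {i : ℕ} :
    i ∈ succs T.carrier u ↔ i :: u ∈ T.carrier :=
  mem_succs.trans ⟨fun h => h.2, fun h => ⟨T.lt_width i u h, h⟩⟩

/-- The nodes comparable with `t`. -/
def cone (t : List ℕ) : Set (List ℕ) := {s | s <:+ t ∨ t <:+ s}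

theorem suffix_of_mem_cone {s t : List ℕ} (h : s ∈ cone t) (hl : t.length ≤ s.length) :
    t <:+ s := by
  rcases h with h | h
  · rw [h.eq_of_length_le hl]
  · exact h

/-- The subtree of the nodes comparable with a given node. -/
def Tree.restrict (T : Tree) (t : List ℕ) (ht : t ∈ T.carrier) : Tree where
  carrier := T.carrier ∩ cone t
  nil_mem := ⟨T.nil_mem, Or.inl List.nil_suffix⟩
  tail_mem i s h := by
    refine ⟨T.tail_mem i s h.1, ?_⟩
    rcases h.2 with h | h
    · exact Or.inl ((List.suffix_cons i s).trans h)
    · rcases List.suffix_cons_iff.1 h with rfl | h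
      · exact Or.inl (List.suffix_cons i s)
      · exact Or.inr h
  lt_width i s h := T.lt_width i s h.1
  exists_isBig := by
    have key : ∀ s ∈ T.carrier, t <:+ s → ∀ n, ∃ u ∈ T.carrier ∩ cone t, s <:+ u ∧
        IsBig (T.carrier ∩ cone t) n u := by
      intro s hs hts n
      obtain ⟨u, hu, hsu, hbig⟩ := T.exists_isBig s hs n
      refine ⟨u, ⟨hu, Or.inr (hts.trans hsu)⟩, hsu, ?_⟩
      refine lt_of_lt_of_le hbig (Finset.card_le_card fun i hi => ?_)
      have hi' := mem_succs.1 hi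
      exact mem_succs.2 ⟨hi'.1, hi'.2,
        Or.inr (hts.trans (hsu.trans (List.suffix_cons i u)))⟩
    rintro s ⟨hs, h | h⟩ n
    · obtain ⟨u, hu, htu, hbig⟩ := key t ht List.suffix_rfl n
      exact ⟨u, hu, h.trans htu, hbig⟩
    · exact key s hs h n

theorem Tree.restrict_le (T : Tree) (t : List ℕ) (ht : t ∈ T.carrier) : T.restrict t ht ≤ T :=
  Set.inter_subset_left

theorem Tree.restrict_mono {T S : Tree} (h : T ≤ S) {t : List ℕ} (ht : t ∈ T.carrier) :
    T.restrict t ht ≤ S.restrict t (h ht) :=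
  Set.inter_subset_inter_left _ h

theorem Tree.exists_lt_length (T : Tree) (n : ℕ) : ∃ t ∈ T.carrier, n < t.length := by
  induction n with
  | zero =>
    obtain ⟨u, -, -, hbig⟩ := T.exists_isBig [] T.nil_mem 0
    obtain ⟨i, hi, -⟩ := exists_ne_of_bound_pow_lt_card hbig
    exact ⟨i :: u, T.cons_mem_succs.1 hi, by simp⟩
  | succ n ih =>
    obtain ⟨t, ht, hn⟩ := ih
    obtain ⟨u, -, htu, hbig⟩ := T.exists_isBig t ht 0
    obtain ⟨i, hi, -⟩ := exists_ne_of_bound_pow_lt_card hbig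
    exact ⟨i :: u, T.cons_mem_succs.1 hi, by simpa using hn.trans_le htu.length_le⟩

/-- A tree has nodes of unbounded length, so it lies in at most one of the cones of two
incomparable nodes. -/
theorem Tree.eq_of_subset_cone (T : Tree) {u : List ℕ} {i j : ℕ} (hi : T.carrier ⊆ cone (i :: u))
    (hj : T.carrier ⊆ cone (j :: u)) : i = j := by
  obtain ⟨t, ht, hn⟩ := T.exists_lt_length u.length
  exact eq_of_cons_suffix_of_cons_suffix
    (suffix_of_mem_cone (hi ht) (by simpa using hn))
    (suffix_of_mem_cone (hj ht) (by simpa using hn))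

/-- The full tree. -/
def fullTree : Tree where
  carrier := {s | ∀ i t, i :: t <:+ s → i < width (Encodable.encode t)}
  nil_mem i t h := by simp at h
  tail_mem i s h j t hjt := h j t (hjt.trans (List.suffix_cons i s))
  lt_width i s h := h i s List.suffix_rfl
  exists_isBig := by
    intro t ht n
    have hext : ∀ k, ∃ u, (∀ i s, i :: s <:+ u → i < width (Encodable.encode s)) ∧ t <:+ u ∧
        k ≤ Encodable.encode u := by
      intro k
      induction k with
      | zero => exact ⟨t, ht, List.suffix_rfl, Nat.zero_le _⟩
      | succ k ih =>
        obtain ⟨u, hu, htu, hk⟩ := ih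
        refine ⟨0 :: u, fun i s h => ?_, htu.trans (List.suffix_cons 0 u),
          hk.trans_lt (encode_lt_of_cons_suffix (List.suffix_rfl (l := 0 :: u)))⟩
        rcases List.suffix_cons_iff.1 h with h | h
        · simp only [List.cons.injEq] at h
          rw [h.1]
          exact width_pos _
        · exact hu i s h
    obtain ⟨u, hu, htu, hn⟩ := hext n
    refine ⟨u, hu, htu, ?_⟩
    have hs : succs {s | ∀ i t, i :: t <:+ s → i < width (Encodable.encode t)} u =
        Finset.range (width (Encodable.encode u)) := by
      ext i
      rw [mem_succs, Finset.mem_range, and_iff_left_iff_imp]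
      intro hi j t h
      rcases List.suffix_cons_iff.1 h with h | h
      · simp only [List.cons.injEq] at h
        rw [h.1, h.2]
        exact hi
      · exact hu j t h
    rw [IsBig, hs, Finset.card_range, width, Nat.lt_succ_iff]
    exact Nat.pow_le_pow_right (bound_pos _) hn

theorem Tree.le_fullTree (T : Tree) : T ≤ fullTree :=
  fun _ hs i t h => T.lt_width i t (T.mem_of_suffix hs h)

end Trees

/-! ### Fusion -/

section Fusion

/-- One step of a fusion: a node `u` of `C` with a large set of successors kept, together with
a condition above each of these successors. -/
structure Step (C : Tree) (n : ℕ) where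
  node : List ℕ
  node_mem : node ∈ C.carrier
  kept : Finset ℕ
  lt_card : bound (Encodable.encode node) ^ n < kept.card
  next : ℕ → Tree
  next_le : ∀ r ∈ kept, next r ≤ C
  cons_mem : ∀ r ∈ kept, r :: node ∈ (next r).carrier
  subset_cone : ∀ r ∈ kept, (next r).carrier ⊆ cone (r :: node)

/-- The nodes of the tree obtained by iterating the given steps. -/
inductive FusionMem (σ : ∀ C n, Step C n) : Tree → ℕ → List ℕ → Prop
  | base {C n t} : t <:+ (σ C n).node → FusionMem σ C n t
  | step {C n r t} : r ∈ (σ C n).kept → FusionMem σ ((σ C n).next r) (n + 1) t →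
      FusionMem σ C n t

variable {σ : ∀ C n, Step C n} {C : Tree} {n : ℕ}

theorem Step.suffix_node {D : Tree} {m : ℕ} (y : Step D m) {v : List ℕ}
    (h : D.carrier ⊆ cone v) : v <:+ y.node := by
  rcases h y.node_mem with hv | hv
  · by_cases hne : y.node = v
    · rw [hne]
    obtain ⟨k, hk⟩ := exists_cons_suffix hv hne
    have huniq : ∀ i ∈ y.kept, i = k := by
      intro i hi
      have hmem := h (y.next_le i hi (y.cons_mem i hi))
      rcases hmem with h3 | h3
      · exact eq_of_cons_suffix_of_cons_suffix h3 hk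
      · exact (eq_of_cons_suffix_of_cons_suffix (hk.trans h3) List.suffix_rfl).symm
    obtain ⟨i, hi, j, hj, hij⟩ := exists_ne_of_bound_pow_lt_card y.lt_card
    exact (hij ((huniq i hi).trans (huniq j hj).symm)).elim
  · exact hv

theorem FusionMem.mem {t : List ℕ} (h : FusionMem σ C n t) : t ∈ C.carrier := by
  induction h with
  | base h => exact Tree.mem_of_suffix _ (σ _ _).node_mem h
  | step hr _ ih => exact (σ _ _).next_le _ hr ih

theorem FusionMem.cons_node {r : ℕ} (hr : r ∈ (σ C n).kept) :
    FusionMem σ C n (r :: (σ C n).node) :=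
  .step hr (.base (Step.suffix_node _ ((σ C n).subset_cone r hr)))

theorem FusionMem.exists_isBig_add (σ : ∀ C n, Step C n) (j : ℕ) : ∀ C n, ∃ u,
    FusionMem σ C n u ∧ (σ C n).node <:+ u ∧ IsBig {t | FusionMem σ C n t} (n + j) u := by
  induction j with
  | zero =>
    intro C n
    refine ⟨_, .base List.suffix_rfl, List.suffix_rfl, ?_⟩
    refine (σ C n).lt_card.trans_le (Finset.card_le_card fun r hr => mem_succs.2 ⟨?_, ?_⟩)
    · exact C.lt_width _ _ (FusionMem.cons_node hr).mem
    · exact FusionMem.cons_node hr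
  | succ j ih =>
    intro C n
    obtain ⟨r, hr, -⟩ := exists_ne_of_bound_pow_lt_card (σ C n).lt_card
    obtain ⟨u, hu, hsu, hbig⟩ := ih ((σ C n).next r) (n + 1)
    refine ⟨u, .step hr hu, ?_, hbig.mono (fun _ ht => FusionMem.step hr ht) (by omega)⟩
    exact (List.suffix_cons r _).trans
      ((Step.suffix_node _ ((σ C n).subset_cone r hr)).trans hsu)

/-- The tree obtained by iterating the given steps. -/
def fusion (σ : ∀ C n, Step C n) (C : Tree) (n : ℕ) : Tree where
  carrier := {t | FusionMem σ C n t}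
  nil_mem := .base List.nil_suffix
  tail_mem i s h := by
    change FusionMem σ C n s
    replace h : FusionMem σ C n (i :: s) := h
    generalize ht : i :: s = t at h
    induction h with
    | base h => exact .base ((List.suffix_cons i s).trans (ht ▸ h))
    | step hr _ ih => exact .step hr (ih ht)
  lt_width i s h := C.lt_width i s (FusionMem.mem h)
  exists_isBig := by
    intro t ht m
    replace ht : FusionMem σ C n t := ht
    induction ht with
    | base h =>
      rename_i C n t
      obtain ⟨u, hu, hsu, hbig⟩ := FusionMem.exists_isBig_add σ m C n
      exact ⟨u, hu, h.trans hsu, hbig.mono subset_rfl (by omega)⟩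
    | step hr _ ih =>
      obtain ⟨u, hu, hsu, hbig⟩ := ih
      exact ⟨u, FusionMem.step hr hu, hsu, hbig.mono (fun _ ht => FusionMem.step hr ht) le_rfl⟩

theorem fusion_le (σ : ∀ C n, Step C n) (C : Tree) (n : ℕ) : fusion σ C n ≤ C :=
  fun _ h => FusionMem.mem h

theorem mem_fusion_next {r : ℕ} {y : List ℕ}
    (hy : y ∈ (fusion σ C n).carrier) (h : r :: (σ C n).node <:+ y) :
    y ∈ (fusion σ ((σ C n).next r) (n + 1)).carrier := by
  rcases hy with hy | ⟨hr', hy⟩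
  · have := (h.trans hy).length_le
    simp at this
  · rename_i r'
    suffices r' = r by rw [← this]; exact hy
    refine eq_of_cons_suffix_of_cons_suffix
      (suffix_of_mem_cone ((σ C n).subset_cone r' hr' (FusionMem.mem hy)) ?_) h
    simpa using h.length_le

/-- Every node of a fusion that is longer than the first splitting node lies above one of the
kept successors. -/
theorem exists_cons_node_suffix {y : List ℕ} (hy : y ∈ (fusion σ C n).carrier)
    (h : (σ C n).node.length < y.length) :
    ∃ r ∈ (σ C n).kept, r :: (σ C n).node <:+ y := by
  rcases hy with hy | ⟨hr, hy⟩
  · exact absurd hy.length_le (by omega)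
  · exact ⟨_, hr, suffix_of_mem_cone ((σ C n).subset_cone _ hr (FusionMem.mem hy))
      (by simpa using h)⟩

theorem restrict_fusion_le {r : ℕ} {y : List ℕ} (hy : y ∈ (fusion σ C n).carrier)
    (h : r :: (σ C n).node <:+ y) :
    (fusion σ C n).restrict y hy ≤
      (fusion σ ((σ C n).next r) (n + 1)).restrict y (mem_fusion_next hy h) := by
  rintro x ⟨hx, hc | hc⟩
  · exact ⟨Tree.mem_of_suffix _ (mem_fusion_next hy h) hc, Or.inl hc⟩
  · exact ⟨mem_fusion_next hx (h.trans hc), Or.inr hc⟩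

theorem eq_of_cons_suffix_node {i j : ℕ} {t : List ℕ} (hi : i :: t <:+ (σ C n).node)
    (hj : j :: t ∈ (fusion σ C n).carrier) : i = j := by
  rcases hj with hj | ⟨hr, hj⟩
  · exact eq_of_cons_suffix_of_cons_suffix hi hj
  · rename_i r
    have hir := hi.trans (List.suffix_cons r (σ C n).node)
    rcases (σ C n).subset_cone _ hr (FusionMem.mem hj) with h | h
    · exact eq_of_cons_suffix_of_cons_suffix hir h
    · exact eq_of_cons_suffix_of_cons_suffix (hir.trans h) List.suffix_rfl

variable {B : Type*} [CompleteBooleanAlgebra B] {ι : Tree → B}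

theorem exists_fusion_next_inf_ne_bot (hι : IsCompletion ι) {b : B}
    (h : ι (fusion σ C n) ⊓ b ≠ ⊥) :
    ∃ r ∈ (σ C n).kept, ι (fusion σ ((σ C n).next r) (n + 1)) ⊓ b ≠ ⊥ := by
  obtain ⟨R, hR, hb⟩ := hι.exists_le h
  obtain ⟨x, hx, hlen⟩ := R.exists_lt_length (σ C n).node.length
  obtain ⟨r, hr, hrx⟩ := exists_cons_node_suffix (hR hx) hlen
  refine ⟨r, hr, fun h0 => hι.ne_bot (R.restrict x hx) (le_bot_iff.1 (h0 ▸ le_inf ?_ ?_))⟩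
  · exact hι.mono ((Tree.restrict_mono hR hx).trans
      ((restrict_fusion_le (hR hx) hrx).trans (Tree.restrict_le _ _ _)))
  · exact (hι.mono (R.restrict_le x hx)).trans hb

end Fusion

/-! ### Separating the successors in a tree -/

section Separation

variable {B : Type*} [CompleteBooleanAlgebra B] {ι : Tree → B} {A : Set B}

theorem exists_le_upper_inf_upper_eq_bot (hι : IsCompletion ι) (hA : IsCompleteSubalgebra A)
    (hatom : ∀ a ∈ A, a ≠ ⊥ → ∃ b ∈ A, ⊥ < b ∧ b < a) (C₁ C₂ : Tree) :
    ∃ D₁ ≤ C₁, ∃ D₂ ≤ C₂, upper A (ι D₁) ⊓ upper A (ι D₂) = ⊥ := by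
  obtain ⟨c, hc, hc0, hca⟩ := hatom (upper A (ι C₁)) (upper_mem hA _)
    (ne_bot_of_le_ne_bot (hι.ne_bot C₁) (le_upper A _))
  have h1 : ι C₁ ⊓ c ≠ ⊥ := by
    intro h
    have := upper_inf_eq_bot hA hc h
    rw [inf_eq_right.2 hca.le] at this
    exact hc0.ne' this
  have h2 : ι C₁ ⊓ cᶜ ≠ ⊥ := by
    intro h
    rw [← disjoint_iff, disjoint_compl_right_iff] at h
    exact hca.not_ge (upper_le hc h)
  have key : ∀ {d : B} {D₁ D₂ : Tree}, d ∈ A → ι D₁ ≤ d → ι D₂ ≤ dᶜ →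
      upper A (ι D₁) ⊓ upper A (ι D₂) = ⊥ := by
    intro d D₁ D₂ hd hd₁ hd₂
    refine le_bot_iff.1 ((inf_le_inf (upper_le hd hd₁) (upper_le (hA.2.2.1 d hd) hd₂)).trans ?_)
    rw [inf_compl_self]
  by_cases h3 : ι C₂ ⊓ c = ⊥
  · obtain ⟨D₁, hD₁, hd₁⟩ := hι.exists_le h1
    refine ⟨D₁, hD₁, C₂, le_rfl, key hc hd₁ ?_⟩
    rwa [le_compl_iff_disjoint_right, disjoint_iff]
  · obtain ⟨D₂, hD₂, hd₂⟩ := hι.exists_le h3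
    obtain ⟨D₁, hD₁, hd₁⟩ := hι.exists_le h2
    refine ⟨D₁, hD₁, D₂, hD₂, ?_⟩
    rw [inf_comm]
    exact key hc hd₂ hd₁

theorem exists_le_pairwise_upper_inf_upper_eq_bot (hι : IsCompletion ι)
    (hA : IsCompleteSubalgebra A)
    (hatom : ∀ a ∈ A, a ≠ ⊥ → ∃ b ∈ A, ⊥ < b ∧ b < a) (C : ℕ → Tree) (Q : Finset (ℕ × ℕ)) :
    ∃ D : ℕ → Tree, (∀ r, D r ≤ C r) ∧
      ∀ p ∈ Q, p.1 ≠ p.2 → upper A (ι (D p.1)) ⊓ upper A (ι (D p.2)) = ⊥ := by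
  induction Q using Finset.induction_on with
  | empty => exact ⟨C, fun _ => le_rfl, by simp⟩
  | insert p Q _ ih =>
    obtain ⟨D, hD, hQ⟩ := ih
    obtain ⟨D₁, hD₁, D₂, hD₂, h⟩ :=
      exists_le_upper_inf_upper_eq_bot hι hA hatom (D p.1) (D p.2)
    have hle : ∀ r, Function.update (Function.update D p.1 D₁) p.2 D₂ r ≤ D r := by
      intro r
      by_cases h2 : r = p.2
      · subst h2; simpa using hD₂
      by_cases h1 : r = p.1
      · subst h1; simpa [h2] using hD₁
      · simp [h1, h2]
    refine ⟨_, fun r => (hle r).trans (hD r), ?_⟩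
    intro q hq hne
    rcases Finset.mem_insert.1 hq with rfl | hq
    · simpa [hne] using h
    · refine le_bot_iff.1 (le_trans (inf_le_inf ?_ ?_) (hQ q hq hne).le)
      · exact upper_mono (hι.mono (hle _))
      · exact upper_mono (hι.mono (hle _))

theorem exists_step_upper_inf_upper_eq_bot (hι : IsCompletion ι) (hA : IsCompleteSubalgebra A)
    (hatom : ∀ a ∈ A, a ≠ ⊥ → ∃ b ∈ A, ⊥ < b ∧ b < a) (C : Tree) (n : ℕ) :
    ∃ x : Step C n, ∀ r ∈ x.kept, ∀ r' ∈ x.kept, r ≠ r' →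
      upper A (ι (x.next r)) ⊓ upper A (ι (x.next r')) = ⊥ := by
  classical
  obtain ⟨u, hu, -, hbig⟩ := C.exists_isBig [] C.nil_mem n
  obtain ⟨D, hD, hQ⟩ := exists_le_pairwise_upper_inf_upper_eq_bot hι hA hatom
    (fun r => if h : r :: u ∈ C.carrier then C.restrict _ h else C)
    (succs C.carrier u ×ˢ succs C.carrier u)
  have hD' : ∀ r (hr : r ∈ succs C.carrier u), D r ≤ C.restrict (r :: u) (mem_succs.1 hr).2 := by
    intro r hr
    have h := hD r
    rwa [dif_pos (mem_succs.1 hr).2] at h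
  have hsub : ∀ r ∈ succs C.carrier u, (D r).carrier ⊆ cone (r :: u) :=
    fun r hr => Set.Subset.trans (hD' r hr) Set.inter_subset_right
  refine ⟨⟨u, hu, succs C.carrier u, hbig, D, fun r hr => (hD' r hr).trans (C.restrict_le _ _),
    fun r hr => ?_, hsub⟩, fun r hr r' hr' => hQ (r, r') (Finset.mk_mem_product hr hr')⟩
  obtain ⟨x, hx, hlen⟩ := (D r).exists_lt_length u.length
  exact (D r).mem_of_suffix hx (suffix_of_mem_cone (hsub r hr hx) (by simpa using hlen))

/-- Below each tree there is a tree in which distinct successors of a node are separated by `A`. -/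
theorem exists_le_separated (hι : IsCompletion ι) (hA : IsCompleteSubalgebra A)
    (hatom : ∀ a ∈ A, a ≠ ⊥ → ∃ b ∈ A, ⊥ < b ∧ b < a) (S : Tree) :
    ∃ S' ≤ S, ∀ t i j (hi : i :: t ∈ S'.carrier) (hj : j :: t ∈ S'.carrier), i ≠ j →
      upper A (ι (S'.restrict _ hi)) ⊓ upper A (ι (S'.restrict _ hj)) = ⊥ := by
  choose σ hσ using exists_step_upper_inf_upper_eq_bot hι hA hatom
  refine ⟨fusion σ S 0, fusion_le σ S 0, fun t i j hi hj hij => ?_⟩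
  suffices H : ∀ C n v, FusionMem σ C n v → ∀ (hi : i :: t ∈ (fusion σ C n).carrier)
      (hj : j :: t ∈ (fusion σ C n).carrier), v = i :: t →
      upper A (ι ((fusion σ C n).restrict _ hi)) ⊓ upper A (ι ((fusion σ C n).restrict _ hj)) = ⊥
    from H S 0 _ hi hi hj rfl
  intro C n v hv
  induction hv with
  | base hv =>
    intro hi hj hvt
    exact (hij (eq_of_cons_suffix_node (hvt ▸ hv) hj)).elim
  | @step C n r v hr hv ih =>
    intro hi hj hvt
    subst hvt
    have aux : ∀ r' k (hk : k :: t ∈ cone (r' :: (σ C n).node)),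
        ¬ k :: t <:+ (σ C n).node → r' :: (σ C n).node <:+ k :: t := by
      rintro r' k (hk | hk) hnot
      · rcases List.suffix_cons_iff.1 hk with hk | hk
        · rw [hk]
        · exact (hnot hk).elim
      · exact hk
    have hri := aux r i ((σ C n).subset_cone r hr hv.mem)
      fun h => hij (eq_of_cons_suffix_node h hj)
    have hnot : ¬ j :: t <:+ (σ C n).node := fun h => hij (eq_of_cons_suffix_node h hi).symm
    rcases id hj with hj' | ⟨hr', hj'⟩
    · exact (hnot hj').elim
    rename_i r'
    have hrj := aux r' j ((σ C n).subset_cone r' hr' hj'.mem) hnot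
    by_cases hrr : r = r'
    · subst hrr
      refine le_bot_iff.1 (le_trans (inf_le_inf ?_ ?_)
        (ih (mem_fusion_next hi hri) (mem_fusion_next hj hrj) rfl).le)
      · exact upper_mono (hι.mono (restrict_fusion_le hi hri))
      · exact upper_mono (hι.mono (restrict_fusion_le hj hrj))
    · refine le_bot_iff.1 (le_trans (inf_le_inf ?_ ?_) (hσ C n r hr r' hr' hrr).le)
      · exact upper_mono (hι.mono ((restrict_fusion_le hi hri).trans
          ((Tree.restrict_le _ _ _).trans (fusion_le _ _ _))))
      · exact upper_mono (hι.mono ((restrict_fusion_le hj hrj).trans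
          ((Tree.restrict_le _ _ _).trans (fusion_le _ _ _))))

end Separation

/-! ### Avoiding most successors -/

section Avoidance

variable {B : Type*} [CompleteBooleanAlgebra B] {ι : Tree → B} {b : ℕ → ℕ → B}

theorem exists_le_forall_ne_inf_eq_bot (hι : IsCompletion ι)
    (hb : ∀ k i j, i ≠ j → b k i ⊓ b k j = ⊥) (C : Tree) (m : ℕ) :
    ∃ D ≤ C, ∃ c : ℕ → ℕ, ∀ k < m, c k < width k ∧
      ∀ i < width k, i ≠ c k → ι D ⊓ b k i = ⊥ := by
  induction m with
  | zero => exact ⟨C, le_rfl, id, by simp⟩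
  | succ m ih =>
    obtain ⟨D, hD, c, hc⟩ := ih
    obtain ⟨E, hE, j, hj, hjE⟩ : ∃ E ≤ D, ∃ j < width m, ∀ i < width m, i ≠ j →
        ι E ⊓ b m i = ⊥ := by
      by_cases h : ∃ j < width m, ι D ⊓ b m j ≠ ⊥
      · obtain ⟨j, hj, hne⟩ := h
        obtain ⟨E, hE, hEb⟩ := hι.exists_le hne
        refine ⟨E, hE, j, hj, fun i _ hij => le_bot_iff.1 ?_⟩
        exact (inf_le_inf_right _ hEb).trans (hb m j i hij.symm).le
      · push Not at h
        exact ⟨D, le_rfl, 0, width_pos m, fun i hi _ => h i hi⟩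
    refine ⟨E, hE.trans hD, Function.update c m j, fun k hk => ?_⟩
    by_cases hkm : k = m
    · subst hkm
      simpa using ⟨hj, hjE⟩
    · obtain ⟨h1, h2⟩ := hc k (by omega)
      rw [Function.update_of_ne hkm]
      refine ⟨h1, fun i hi hik => le_bot_iff.1 ?_⟩
      exact (inf_le_inf_right _ (hι.mono hE)).trans (h2 i hi hik).le

theorem exists_step_forall_ne_inf_eq_bot (hι : IsCompletion ι)
    (hb : ∀ k i j, i ≠ j → b k i ⊓ b k j = ⊥) (C : Tree) (n : ℕ) :
    ∃ x : Step C n, ∀ k < Encodable.encode x.node, ∃ c, ∀ r ∈ x.kept, ∀ i < width k, i ≠ c →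
      ι (x.next r) ⊓ b k i = ⊥ := by
  classical
  obtain ⟨u, hu, -, hbig⟩ := C.exists_isBig [] C.nil_mem (n + 1)
  set m := Encodable.encode u with hm
  have H : ∀ r, ∃ D : Tree, ∃ c : ℕ → ℕ, (∀ h : r :: u ∈ C.carrier, D ≤ C.restrict _ h) ∧
      ∀ k < m, c k < width k ∧ ∀ i < width k, i ≠ c k → ι D ⊓ b k i = ⊥ := by
    intro r
    obtain ⟨D, hD, c, hc⟩ := exists_le_forall_ne_inf_eq_bot hι hb
      (if h : r :: u ∈ C.carrier then C.restrict _ h else C) m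
    refine ⟨D, c, fun h => ?_, hc⟩
    rwa [dif_pos h] at hD
  choose D c hD hc using H
  obtain ⟨f, -, hf⟩ := Finset.exists_lt_card_fiber_of_mul_lt_card_of_maps_to
    (s := succs C.carrier u) (t := Fintype.piFinset fun k : Fin m => Finset.range (width k))
    (f := fun r k => c r k) (n := bound m ^ n)
    (fun r _ => Fintype.mem_piFinset.2 fun k => Finset.mem_range.2 (hc r k k.2).1) (by
      have hcard : (Fintype.piFinset fun k : Fin m => Finset.range (width k)).card = bound m := by
        rw [Fintype.card_piFinset, bound_eq_prod, ← Fin.prod_univ_eq_prod_range]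
        simp
      rw [hcard, ← pow_succ']
      exact hbig)
  have hmem : ∀ r ∈ (succs C.carrier u).filter (fun r => (fun k : Fin m => c r k) = f),
      r :: u ∈ C.carrier := fun r hr => (mem_succs.1 (Finset.mem_filter.1 hr).1).2
  have hsub : ∀ r ∈ (succs C.carrier u).filter (fun r => (fun k : Fin m => c r k) = f),
      (D r).carrier ⊆ cone (r :: u) :=
    fun r hr => Set.Subset.trans (hD r (hmem r hr)) Set.inter_subset_right
  refine ⟨⟨u, hu, _, hf, D, fun r hr => (hD r (hmem r hr)).trans (C.restrict_le _ _),
    fun r hr => ?_, hsub⟩, fun k hk => ⟨f ⟨k, hk⟩, fun r hr i hi hne => ?_⟩⟩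
  · obtain ⟨x, hx, hlen⟩ := (D r).exists_lt_length u.length
    exact (D r).mem_of_suffix hx (suffix_of_mem_cone (hsub r hr hx) (by simpa using hlen))
  · refine (hc r k hk).2 i hi ?_
    have := congrFun (Finset.mem_filter.1 hr).2 ⟨k, hk⟩
    exact fun h => hne (h.trans this)

open Classical in
/-- Below each tree `T` there is a tree compatible with only few members of each of the given
antichains, except for those indexed by the nodes of `T`. -/
theorem exists_le_card_le_bound (hι : IsCompletion ι)
    (hb : ∀ k i j, i ≠ j → b k i ⊓ b k j = ⊥) (T : Tree) :
    ∃ T' ≤ T, ∀ k, (∀ u ∈ T.carrier, Encodable.encode u ≠ k) →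
      ((Finset.range (width k)).filter fun i => ι T' ⊓ b k i ≠ ⊥).card ≤ bound k := by
  choose σ hσ using exists_step_forall_ne_inf_eq_bot hι hb
  refine ⟨fusion σ T 0, fusion_le σ T 0, fun k hk => ?_⟩
  have base : ∀ C n, C ≤ T → k ≤ Encodable.encode (σ C n).node →
      ((Finset.range (width k)).filter fun i => ι (fusion σ C n) ⊓ b k i ≠ ⊥).card ≤
        ∏ i ∈ Finset.Ico (Encodable.encode (σ C n).node) k, width i := by
    intro C n hC hkd
    rw [Finset.Ico_eq_empty_of_le hkd, Finset.prod_empty]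
    obtain ⟨c, hc⟩ := hσ C n k
      (lt_of_le_of_ne hkd (hk _ (hC (σ C n).node_mem)).symm)
    refine (Finset.card_le_card (t := {c}) fun i hi => ?_).trans (Finset.card_singleton c).le
    rw [Finset.mem_filter, Finset.mem_range] at hi
    rw [Finset.mem_singleton]
    by_contra hne
    obtain ⟨r, hr, h⟩ := exists_fusion_next_inf_ne_bot hι hi.2
    exact h (le_bot_iff.1 ((inf_le_inf_right _ (hι.mono (fusion_le _ _ _))).trans
      (hc r hr i hi.1 hne).le))
  have key : ∀ d C n, C ≤ T → k ≤ Encodable.encode (σ C n).node + d →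
      ((Finset.range (width k)).filter fun i => ι (fusion σ C n) ⊓ b k i ≠ ⊥).card ≤
        ∏ i ∈ Finset.Ico (Encodable.encode (σ C n).node) k, width i := by
    intro d
    induction d with
    | zero => exact base
    | succ d ih =>
      intro C n hC hkd
      rcases le_or_gt k (Encodable.encode (σ C n).node) with hlt | hlt
      · exact base C n hC hlt
      · rw [Finset.prod_eq_prod_Ico_succ_bot hlt]
        set m := Encodable.encode (σ C n).node with hm
        have hsub : ((Finset.range (width k)).filter fun i => ι (fusion σ C n) ⊓ b k i ≠ ⊥) ⊆
            (σ C n).kept.biUnion fun r => (Finset.range (width k)).filter fun i =>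
              ι (fusion σ ((σ C n).next r) (n + 1)) ⊓ b k i ≠ ⊥ := by
          intro i hi
          rw [Finset.mem_filter] at hi
          obtain ⟨r, hr, h⟩ := exists_fusion_next_inf_ne_bot hι hi.2
          exact Finset.mem_biUnion.2 ⟨r, hr, Finset.mem_filter.2 ⟨hi.1, h⟩⟩
        refine (Finset.card_le_card hsub).trans ((Finset.card_biUnion_le_card_mul _ _
          (∏ i ∈ Finset.Ico (m + 1) k, width i) fun r hr => ?_).trans ?_)
        · have hlt' : m < Encodable.encode (σ ((σ C n).next r) (n + 1)).node :=
            encode_lt_of_cons_suffix (Step.suffix_node _ ((σ C n).subset_cone r hr))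
          refine (ih _ (n + 1) (((σ C n).next_le r hr).trans hC) (by omega)).trans ?_
          exact Finset.prod_le_prod_of_subset_of_one_le' (Finset.Ico_subset_Ico_left hlt')
            fun i _ _ => width_pos i
        · refine Nat.mul_le_mul_right _ ?_
          calc (σ C n).kept.card ≤ (Finset.range (width m)).card :=
                Finset.card_le_card fun r hr => Finset.mem_range.2
                  (C.lt_width _ _ ((σ C n).next_le r hr ((σ C n).cons_mem r hr)))
            _ = width m := Finset.card_range _
  refine (key k T 0 le_rfl (Nat.le_add_left _ _)).trans ?_
  rw [bound_eq_prod, Finset.range_eq_Ico]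
  exact Finset.prod_le_prod_of_subset_of_one_le' (Finset.Ico_subset_Ico_left (Nat.zero_le _))
    fun i _ _ => width_pos i

end Avoidance

/-! ### The main theorem -/

section Main

variable {B : Type*} [CompleteBooleanAlgebra B] {ι : Tree → B} {A : Set B}

theorem restrict_inf_restrict_eq_bot (hι : IsCompletion ι) {T S : Tree} {u : List ℕ} {i j : ℕ}
    (hi : i :: u ∈ T.carrier) (hj : j :: u ∈ S.carrier) (hij : i ≠ j) :
    ι (T.restrict _ hi) ⊓ ι (S.restrict _ hj) = ⊥ := by
  by_contra h
  obtain ⟨R, hRT, hRS⟩ := hι.compat _ _ h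
  exact hij (R.eq_of_subset_cone (Set.Subset.trans hRT Set.inter_subset_right)
    (Set.Subset.trans hRS Set.inter_subset_right))

theorem Tree.exists_ne_cons_mem (T : Tree) :
    ∃ u i j, i :: u ∈ T.carrier ∧ j :: u ∈ T.carrier ∧ i ≠ j := by
  obtain ⟨u, -, -, hbig⟩ := T.exists_isBig [] T.nil_mem 0
  obtain ⟨i, hi, j, hj, hij⟩ := exists_ne_of_bound_pow_lt_card hbig
  exact ⟨u, i, j, T.cons_mem_succs.1 hi, T.cons_mem_succs.1 hj, hij⟩

theorem not_isAtom (hι : IsCompletion ι) (b : B) : ¬ IsAtom b := by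
  intro hb
  obtain ⟨T, hT⟩ := hι.dense b hb.1
  obtain ⟨u, i, j, hi, hj, hij⟩ := T.exists_ne_cons_mem
  have key : ∀ R ≤ T, ι R = b := fun R hR =>
    (hb.le_iff.1 ((hι.mono hR).trans hT)).resolve_left (hι.ne_bot R)
  have h := restrict_inf_restrict_eq_bot hι hi hj hij
  rw [key _ (T.restrict_le _ hi), key _ (T.restrict_le _ hj), inf_idem] at h
  exact hb.1 h

theorem eq_univ_of_atomless (hι : IsCompletion ι) (hA : IsCompleteSubalgebra A)
    (hatom : ∀ a ∈ A, a ≠ ⊥ → ∃ b ∈ A, ⊥ < b ∧ b < a) : A = Set.univ := by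
  classical
  rw [Set.eq_univ_iff_forall]
  by_contra! hne
  obtain ⟨b, hb⟩ := hne
  obtain ⟨p, q, hpq, hq0, hqp, -⟩ := exists_upper_eq_upper hA hb
  obtain ⟨S₀, hS₀⟩ := hι.dense q hq0
  obtain ⟨S, hS, hsep⟩ := exists_le_separated hι hA hatom S₀
  have hSq : ι S ≤ q := (hι.mono hS).trans hS₀
  have hpS : p ⊓ upper A (ι S) ≠ ⊥ := by
    intro h
    have h1 := upper_inf_eq_bot hA (upper_mem hA _) h
    refine hι.ne_bot S (le_bot_iff.1 (h1 ▸ le_inf (hSq.trans hqp) (le_upper A _)))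
  obtain ⟨T₀, hT₀⟩ := hι.dense _ hpS
  obtain ⟨t, htT, htS⟩ : ∃ t ∈ T₀.carrier, t ∉ S.carrier := by
    by_contra! h
    have h1 : ι T₀ ≤ ι S := hι.mono (show T₀.carrier ⊆ S.carrier from h)
    exact hι.ne_bot T₀ (le_bot_iff.1 (hpq ▸ le_inf (hT₀.trans inf_le_left) (h1.trans hSq)))
  let β : ℕ → ℕ → B := fun k i =>
    ⨆ (s : List ℕ) (_ : Encodable.encode s = k) (h : i :: s ∈ S.carrier),
      upper A (ι (S.restrict _ h))
  have hβ : ∀ k i j, i ≠ j → β k i ⊓ β k j = ⊥ := by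
    intro k i j hij
    rw [← disjoint_iff]
    simp only [β, iSup_disjoint_iff, disjoint_iSup_iff]
    intro s hs hj s' hs' hi
    obtain rfl : s = s' := Encodable.encode_injective (hs.trans hs'.symm)
    exact disjoint_iff.2 (hsep s i j hi hj hij)
  obtain ⟨T, hT, hcard⟩ := exists_le_card_le_bound hι hβ (T₀.restrict t htT)
  have hTS : ι T ≤ upper A (ι S) :=
    (hι.mono (hT.trans (T₀.restrict_le t htT))).trans (hT₀.trans inf_le_right)
  have hST : ι S ⊓ upper A (ι T) ≠ ⊥ := by
    intro h
    have h1 := upper_inf_eq_bot hA (upper_mem hA _) h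
    exact hι.ne_bot T (le_bot_iff.1 (h1 ▸ le_inf hTS (le_upper A _)))
  obtain ⟨R, hR, hRT⟩ := hι.exists_le hST
  obtain ⟨s₀, hs₀, hlen⟩ := R.exists_lt_length t.length
  obtain ⟨s, hs, hss, hbig⟩ := R.exists_isBig s₀ hs₀ 1
  have hk : ∀ u ∈ (T₀.restrict t htT).carrier, Encodable.encode u ≠ Encodable.encode s := by
    intro u hu h
    obtain rfl := Encodable.encode_injective h
    have h1 := suffix_of_mem_cone hu.2 (hlen.le.trans hss.length_le)
    exact htS (S.mem_of_suffix (hR hs) h1)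
  have hlt := (hcard _ hk).trans_lt ((pow_one (bound _)).symm.trans_lt hbig)
  obtain ⟨i, hi, hiT⟩ : ∃ i ∈ succs R.carrier s, ι T ⊓ β (Encodable.encode s) i = ⊥ := by
    by_contra! h
    refine hlt.not_ge (Finset.card_le_card fun i hi => ?_)
    exact Finset.mem_filter.2 ⟨Finset.mem_range.2 (mem_succs.1 hi).1, h i hi⟩
  have hiR := (mem_succs.1 hi).2
  have h1 : ι T ⊓ upper A (ι (S.restrict _ (hR hiR))) = ⊥ := by
    refine le_bot_iff.1 ((inf_le_inf_left _ ?_).trans hiT.le)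
    exact le_iSup_of_le s (le_iSup_of_le rfl (le_iSup_of_le (hR hiR) le_rfl))
  have h2 := upper_inf_eq_bot hA (upper_mem hA _) h1
  refine hι.ne_bot (R.restrict _ hiR) (le_bot_iff.1 (h2 ▸ le_inf ?_ ?_))
  · exact (hι.mono (R.restrict_le _ hiR)).trans hRT
  · exact (hι.mono (Tree.restrict_mono hR hiR)).trans (le_upper A _)

theorem atomless_of_generators_subset (hι : IsCompletion ι) (hA : IsCompleteSubalgebra A)
    (h : (Set.range fun s : fullTree.carrier => ι (fullTree.restrict s s.2)) ⊆ A) :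
    ∀ a ∈ A, a ≠ ⊥ → ∃ b ∈ A, ⊥ < b ∧ b < a := by
  intro a ha ha0
  obtain ⟨T, hT⟩ := hι.dense a ha0
  obtain ⟨u, i, j, hi, hj, hij⟩ := T.exists_ne_cons_mem
  have hi' := T.le_fullTree hi
  refine ⟨a ⊓ ι (fullTree.restrict _ hi'),
    inf_mem_of_isCompleteSubalgebra hA ha (h ⟨⟨_, hi'⟩, rfl⟩), ?_, inf_lt_left.2 fun hle => ?_⟩
  · refine bot_lt_iff_ne_bot.2 (ne_bot_of_le_ne_bot (hι.ne_bot (T.restrict _ hi)) (le_inf ?_ ?_))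
    · exact (hι.mono (T.restrict_le _ hi)).trans hT
    · exact hι.mono (Tree.restrict_mono T.le_fullTree hi)
  · refine hι.ne_bot (T.restrict _ hj) (le_bot_iff.1 ?_)
    rw [← restrict_inf_restrict_eq_bot hι hi' hj hij]
    exact le_inf (((hι.mono (T.restrict_le _ hj)).trans hT).trans hle) le_rfl

end Main

end SimpleAlgebra

/-- for every regular uncountable cardinal `κ` there is a complete Boolean
algebra `B` (nontrivial, so that `{⊥, ⊤}` really has two elements) such that:
(i) `B` is atomless;
(ii) the only automorphism of `B` (a bijection preserving `⊓`, `⊔` and complements)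
is the identity;
(iii) every atomless complete subalgebra of `B` is `{⊥, ⊤}` or all of `B`;
(iv) some set of at most `κ` elements of `B` is contained in no proper complete
subalgebra of `B` (`B` has `κ` complete generators). -/
theorem statement0 (κ : Cardinal.{u}) (hκreg : κ.IsRegular)
    (hκunc : Cardinal.aleph0 < κ) :
    ∃ (B : Type u) (_ : CompleteBooleanAlgebra B),
      (⊥ : B) ≠ ⊤ ∧
      (∀ b : B, ¬ IsAtom b) ∧
      (∀ e : B ≃ B,
        (∀ x y : B, e (x ⊓ y) = e x ⊓ e y) →
        (∀ x y : B, e (x ⊔ y) = e x ⊔ e y) →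
        (∀ x : B, e xᶜ = (e x)ᶜ) →
        ∀ x : B, e x = x) ∧
      (∀ A : Set B, IsCompleteSubalgebra A →
        (∀ a ∈ A, a ≠ ⊥ → ∃ b ∈ A, ⊥ < b ∧ b < a) →
        A = {⊥, ⊤} ∨ A = Set.univ) ∧
      (∃ X : Set B, Cardinal.mk X ≤ κ ∧
        ∀ A : Set B, IsCompleteSubalgebra A → X ⊆ A → A = Set.univ) := by
  obtain ⟨B, _, ι, hι⟩ := SimpleAlgebra.exists_isCompletion.{u} SimpleAlgebra.Tree
  refine ⟨B, inferInstance, ?_, SimpleAlgebra.not_isAtom hι, fun e hinf _ _ => ?_,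
    fun A hA hatom => Or.inr (SimpleAlgebra.eq_univ_of_atomless hι hA hatom), ?_⟩
  · intro h
    exact hι.ne_bot SimpleAlgebra.fullTree (le_bot_iff.1 (le_top.trans h.ge))
  · have hle : ∀ x y, e x ≤ e y ↔ x ≤ y := fun x y => by
      rw [← inf_eq_left, ← hinf, e.injective.eq_iff, inf_eq_left]
    exact SimpleAlgebra.eq_self_of_forall_atomless_eq_univ (SimpleAlgebra.not_isAtom hι)
      (fun A hA hatom => SimpleAlgebra.eq_univ_of_atomless hι hA hatom) ⟨e, hle _ _⟩
  · refine ⟨Set.range fun s : SimpleAlgebra.fullTree.carrier =>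
      ι (SimpleAlgebra.fullTree.restrict s s.2), ?_, fun A hA hX => ?_⟩
    · exact (Cardinal.le_aleph0_iff_set_countable.2 (Set.countable_range _)).trans hκunc.le
    · exact SimpleAlgebra.eq_univ_of_atomless hι hA
        (SimpleAlgebra.atomless_of_generators_subset hι hA hX)
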